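/- Let H be a group, let x₁, x₂, x₃, x₄ ∈ H, and let T₁, T₂, T₃, T₄ be pairwise disjoint subsets of H such that xⱼh ∈ Tⱼ for every h ∈ H ∖ Tⱼ and every j ∈ {1, 2, 3, 4}. Then u = x₁x₂ and v = x₃x₄ freely generate a non-abelian free subgroup of H; that is, the homomorphism from the free group on two generators to H sending the two generators to u and v respectively is injective. -/

import Mathlib

open scoped Function Pointwise in
/-- The ping-pong lemma for free groups, with the index type and the group in independent
universes. -/
theorem FreeGroup.lift_injective_of_ping_pong.{u, v, w} {ι : Type u} [Nontrivial ι] {G : Type v}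
    [Group G] (a : ι → G) {α : Type w} [MulAction G α] (X Y : ι → Set α)
    (hXnonempty : ∀ i, (X i).Nonempty) (hXdisj : Pairwise (Disjoint on X))
    (hYdisj : Pairwise (Disjoint on Y)) (hXYdisj : ∀ i j, Disjoint (X i) (Y j))
    (hX : ∀ i, a i • (Y i)ᶜ ⊆ X i) (hY : ∀ i, (a i)⁻¹ • (X i)ᶜ ⊆ Y i) :
    Function.Injective (FreeGroup.lift a) := by
  let b : ULift.{v} ι → ULift.{u} G := fun i => ⟨a i.down⟩
  have hb : Function.Injective (FreeGroup.lift b) :=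
    FreeGroup.injective_lift_of_ping_pong b (fun i => X i.down) (fun i => Y i.down)
      (fun i => hXnonempty i.down) (hXdisj.comp_of_injective ULift.down_injective)
      (hYdisj.comp_of_injective ULift.down_injective) (fun i j => hXYdisj i.down j.down)
      (fun i => hX i.down) (fun i => hY i.down)
  have hab : FreeGroup.lift a = MulEquiv.ulift.toMonoidHom.comp
      ((FreeGroup.lift b).comp (FreeGroup.freeGroupCongr Equiv.ulift.symm).toMonoidHom) := by
    ext i
    simp [b]
    rfl
  rw [hab]
  exact MulEquiv.ulift.injective.comp (hb.comp (MulEquiv.injective _))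

/-- Lemma 5.5 (Brin–Picioroaga ping-pong): if `x₁, x₂, x₃, x₄ ∈ H` and `T₁, …, T₄` are
pairwise disjoint subsets of `H` with `xⱼ·(H ∖ Tⱼ) ⊆ Tⱼ` for each `j`, then
`u = x₁x₂` and `v = x₃x₄` freely generate a non-abelian free subgroup of `H`. -/
theorem brin_picioroaga_ping_pong {H : Type*} [Group H]
    (x : Fin 4 → H) (T : Fin 4 → Set H)
    (hdisj : Pairwise fun i j => Disjoint (T i) (T j))
    (hping : ∀ j : Fin 4, ∀ h : H, h ∉ T j → x j * h ∈ T j) :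
    Function.Injective
      ⇑(FreeGroup.lift fun b : Bool => if b then x 0 * x 1 else x 2 * x 3) := by
  have hinv : ∀ j h, h ∉ T j → (x j)⁻¹ * h ∈ T j := fun j h hh => by
    by_contra hn
    exact hh (by simpa using hping j _ hn)
  have hT : ∀ j, (T j).Nonempty := fun j => by
    by_contra hn
    rw [Set.not_nonempty_iff_eq_empty] at hn
    simpa [hn] using hping j 1
  have hd : ∀ {i j : Fin 4}, i ≠ j → ∀ {h}, h ∈ T i → h ∉ T j :=
    fun hij _ hi hj => Set.disjoint_left.mp (hdisj hij) hi hj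
  refine FreeGroup.lift_injective_of_ping_pong _
    (fun b : Bool => if b then T 0 else T 2)
    (fun b : Bool => if b then T 1 else T 3) ?_ ?_ ?_ ?_ ?_ ?_
  · rintro (_ | _) <;> simp [hT]
  · rintro (_ | _) (_ | _) hij <;> first | exact absurd rfl hij | exact hdisj (by decide)
  · rintro (_ | _) (_ | _) hij <;> first | exact absurd rfl hij | exact hdisj (by decide)
  · rintro (_ | _) (_ | _) <;> exact hdisj (by decide)
  · rintro (_ | _) _ ⟨h, hh, rfl⟩
    · simpa [mul_assoc] using hping 2 _ (hd (by decide) (hping 3 h hh))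
    · simpa [mul_assoc] using hping 0 _ (hd (by decide) (hping 1 h hh))
  · rintro (_ | _) _ ⟨h, hh, rfl⟩
    · simpa [mul_assoc] using hinv 3 _ (hd (by decide) (hinv 2 h hh))
    · simpa [mul_assoc] using hinv 1 _ (hd (by decide) (hinv 0 h hh))
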